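/- arXiv:2206.14252 — 7 statements merged into one kernel-verified Lean document; each statement's English description precedes it below -/
import Mathlib

section
/- Let K be a field equipped with a nonarchimedean absolute value |·|, let c ∈ K with |c| > 1, and let α ∈ K with |α| ≠ |c|^{1/2}. Then the sequence n ↦ 2^{-n}·log max(1, |f_c^n(α)|) converges, and its limit equals log max(|α|, |c|^{1/2}). -/
open Filter Topology

/-- A nonarchimedean absolute value of a sum of two elements of different absolute value is
the larger of the two. -/
theorem nonarchimedean_add_eq_max {K : Type*} [Field K] (v : K → ℝ)
    (hnonneg : ∀ x, 0 ≤ v x) (heq0 : ∀ x, v x = 0 ↔ x = 0)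
    (hmul : ∀ x y, v (x * y) = v x * v y)
    (hna : ∀ x y, v (x + y) ≤ max (v x) (v y)) {x y : K} (h : v x ≠ v y) :
    v (x + y) = max (v x) (v y) := by
  have h1 : v 1 = 1 := by
    have h0 : v 1 ≠ 0 := fun h => one_ne_zero ((heq0 1).1 h)
    have h2 := hmul 1 1
    rw [mul_one] at h2
    exact mul_left_cancel₀ h0 (by rw [← h2, mul_one])
  have hneg1 : v (-1) = 1 := by
    have h2 := hmul (-1) (-1)
    rw [neg_mul_neg, mul_one, h1] at h2
    nlinarith [hnonneg (-1)]
  have hneg (z : K) : v (-z) = v z := by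
    rw [← neg_one_mul, hmul, hneg1, one_mul]
  have hx := hna (x + y) (-y)
  have hy := hna (x + y) (-x)
  rw [hneg, add_neg_cancel_right] at hx
  rw [hneg, add_neg_cancel_comm] at hy
  refine le_antisymm (hna x y) ?_
  rcases lt_or_gt_of_ne h with h | h
  · rw [max_eq_right h.le]
    exact (le_max_iff.1 hy).resolve_right h.not_ge
  · rw [max_eq_left h.le]
    exact (le_max_iff.1 hx).resolve_right h.not_ge

/-- The absolute value of the iterates of `z ^ 2 + c` when `|c| > 1` and `|α| ≠ |c|^{1/2}`. -/
theorem nonarchimedean_iterate_sq_add {K : Type*} [Field K] (v : K → ℝ)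
    (hnonneg : ∀ x, 0 ≤ v x) (heq0 : ∀ x, v x = 0 ↔ x = 0)
    (hmul : ∀ x y, v (x * y) = v x * v y)
    (hna : ∀ x y, v (x + y) ≤ max (v x) (v y))
    (c : K) (hc : 1 < v c) (α : K) (hα : v α ≠ Real.sqrt (v c)) (n : ℕ) :
    v ((fun z => z ^ 2 + c)^[n + 1] α) = max (v α) (Real.sqrt (v c)) ^ 2 ^ (n + 1) := by
  have hsq (z : K) : v (z ^ 2) = v z ^ 2 := by rw [sq, hmul, sq]
  have hs : Real.sqrt (v c) ^ 2 = v c := Real.sq_sqrt (hnonneg c)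
  have hs1 : 1 < Real.sqrt (v c) := Real.lt_sqrt_of_sq_lt (by simpa using hc)
  induction n with
  | zero =>
    have hne : v (α ^ 2) ≠ v c := by
      rw [hsq, ← hs]
      exact fun h => hα ((sq_eq_sq₀ (hnonneg α) (Real.sqrt_nonneg _)).1 h)
    simp only [zero_add, Function.iterate_one, pow_one]
    rw [nonarchimedean_add_eq_max v hnonneg heq0 hmul hna hne, hsq]
    rcases le_total (v α) (Real.sqrt (v c)) with h | h
    · rw [max_eq_right h, hs, max_eq_right]
      rw [← hs]
      exact pow_le_pow_left₀ (hnonneg α) h 2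
    · rw [max_eq_left h, max_eq_left]
      rw [← hs]
      exact pow_le_pow_left₀ (Real.sqrt_nonneg _) h 2
  | succ n ih =>
    rw [Function.iterate_succ_apply']
    set x := (fun z => z ^ 2 + c)^[n + 1] α
    set M := max (v α) (Real.sqrt (v c)) with hM
    have hsM : Real.sqrt (v c) ≤ M := le_max_right _ _
    have hM1 : 1 < M := hs1.trans_le hsM
    have hx : v (x ^ 2) = M ^ 2 ^ (n + 1 + 1) := by
      rw [hsq, ih, ← pow_mul, ← pow_succ]
    have hlt : v c < v (x ^ 2) := by
      rw [hx, ← hs]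
      refine (pow_le_pow_left₀ (Real.sqrt_nonneg _) hsM 2).trans_lt (pow_lt_pow_right₀ hM1 ?_)
      have : 1 ≤ 2 ^ n := Nat.one_le_two_pow
      rw [pow_succ, pow_succ]
      omega
    rw [nonarchimedean_add_eq_max v hnonneg heq0 hmul hna hlt.ne', max_eq_left hlt.le, hx]

/-- Over a field with a nonarchimedean absolute value, if `|c| > 1` and
`|α| ≠ |c|^{1/2}`, then `2^{-n}·log max(1, |f_c^n(α)|)` converges to
`log max(|α|, |c|^{1/2})`, where `f_c(z) = z² + c`. -/
theorem stmt_0 {K : Type*} [Field K] (v : K → ℝ)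
    (hnonneg : ∀ x, 0 ≤ v x) (heq0 : ∀ x, v x = 0 ↔ x = 0)
    (hmul : ∀ x y, v (x * y) = v x * v y)
    (hna : ∀ x y, v (x + y) ≤ max (v x) (v y))
    (c : K) (hc : 1 < v c) (α : K) (hα : v α ≠ Real.sqrt (v c)) :
    Tendsto
      (fun n : ℕ => Real.log (max 1 (v ((fun z => z ^ 2 + c)^[n] α))) / 2 ^ n)
      atTop (nhds (Real.log (max (v α) (Real.sqrt (v c))))) := by
  have hM1 : 1 ≤ max (v α) (Real.sqrt (v c)) :=
    (Real.one_le_sqrt.2 hc.le).trans (le_max_right _ _)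
  refine tendsto_const_nhds.congr' ?_
  filter_upwards [eventually_ge_atTop 1] with n hn
  obtain ⟨m, rfl⟩ := Nat.exists_eq_add_of_le' hn
  rw [nonarchimedean_iterate_sq_add v hnonneg heq0 hmul hna c hc α hα m,
    max_eq_right (one_le_pow₀ hM1), Real.log_pow]
  push_cast
  rw [mul_div_cancel_left₀ _ (by positivity)]
end

section
/- Let K be a field equipped with a nonarchimedean absolute value |·| and let c ∈ K. If |c| > 1, then every β ∈ K that is preperiodic for f_c satisfies |β| = |c|^{1/2}. If instead |c| ≤ 1, then every β ∈ K that is preperiodic for f_c satisfies |β| ≤ 1. -/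
/-- The points that are pushed to infinity by `z ↦ z ^ 2 + c`. -/
def escapeRegion {K : Type*} [Field K] (v : AbsoluteValue K ℝ) (c : K) : Set K :=
  {z | 1 < v z ∧ v c < v z ^ 2}

section

variable {K : Type*} [Field K] {v : AbsoluteValue K ℝ} {c z : K}

theorem IsNonarchimedean.map_sq_add_of_mem_escapeRegion (hv : IsNonarchimedean v)
    (hz : z ∈ escapeRegion v c) : v (z ^ 2 + c) = v z ^ 2 := by
  rw [hv.add_eq_left_of_lt (by simpa using hz.2), map_pow]

theorem IsNonarchimedean.mapsTo_escapeRegion (hv : IsNonarchimedean v) :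
    Set.MapsTo (fun z => z ^ 2 + c) (escapeRegion v c) (escapeRegion v c) := by
  intro z hz
  have hsq : 1 < v z ^ 2 := one_lt_pow₀ hz.1 two_ne_zero
  simp only [escapeRegion, Set.mem_ofPred_eq, hv.map_sq_add_of_mem_escapeRegion hz]
  exact ⟨hsq, hz.2.trans (by nlinarith)⟩

theorem IsNonarchimedean.strictMono_iterate_of_mem_escapeRegion (hv : IsNonarchimedean v)
    (hz : z ∈ escapeRegion v c) : StrictMono fun n => v ((fun z => z ^ 2 + c)^[n] z) := by
  refine strictMono_nat_of_lt_succ fun n => ?_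
  have hn := hv.mapsTo_escapeRegion.iterate n hz
  rw [Function.iterate_succ_apply', hv.map_sq_add_of_mem_escapeRegion hn]
  nlinarith [hn.1]

theorem IsNonarchimedean.iterate_notMem_escapeRegion (hv : IsNonarchimedean v) {n m : ℕ}
    (hmn : m < n) (h : (fun z => z ^ 2 + c)^[n] z = (fun z => z ^ 2 + c)^[m] z) (k : ℕ) :
    (fun z => z ^ 2 + c)^[k] z ∉ escapeRegion v c := by
  intro hk
  refine (hv.strictMono_iterate_of_mem_escapeRegion hk hmn).ne' ?_
  simp only [← Function.iterate_add_apply, Nat.add_comm _ k]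
  simp only [Function.iterate_add_apply, h]

end


/-- Over a field with a nonarchimedean absolute value: if `|c| > 1`, every
preperiodic point `β` of `f_c(z) = z² + c` satisfies `|β| = |c|^{1/2}`; if `|c| ≤ 1`, every
preperiodic point satisfies `|β| ≤ 1`. -/
theorem stmt_1 {K : Type*} [Field K] (v : K → ℝ)
    (hnonneg : ∀ x, 0 ≤ v x) (heq0 : ∀ x, v x = 0 ↔ x = 0)
    (hmul : ∀ x y, v (x * y) = v x * v y)
    (hna : ∀ x y, v (x + y) ≤ max (v x) (v y))
    (c : K) :
    (1 < v c → ∀ β : K,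
      (∃ n m : ℕ, m < n ∧ (fun z => z ^ 2 + c)^[n] β = (fun z => z ^ 2 + c)^[m] β) →
      v β = Real.sqrt (v c)) ∧
    (v c ≤ 1 → ∀ β : K,
      (∃ n m : ℕ, m < n ∧ (fun z => z ^ 2 + c)^[n] β = (fun z => z ^ 2 + c)^[m] β) →
      v β ≤ 1) := by
  let w : AbsoluteValue K ℝ :=
    { toFun := v
      map_mul' := hmul
      nonneg' := hnonneg
      eq_zero' := heq0
      add_le' := fun x y => (hna x y).trans (max_le_add_of_nonneg (hnonneg x) (hnonneg y)) }
  have hw : IsNonarchimedean w := hna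
  change (1 < w c → ∀ β : K, _ → w β = Real.sqrt (w c)) ∧ (w c ≤ 1 → ∀ β : K, _ → w β ≤ 1)
  constructor
  · rintro hc β ⟨n, m, hmn, h⟩
    have h₀ : β ∉ escapeRegion w c := hw.iterate_notMem_escapeRegion hmn h 0
    have h₁ : β ^ 2 + c ∉ escapeRegion w c := hw.iterate_notMem_escapeRegion hmn h 1
    refine ((Real.sqrt_eq_iff_eq_sq (w.nonneg c) (w.nonneg β)).2 ?_).symm
    rcases lt_trichotomy (w c) (w β ^ 2) with hlt | heq | hgt
    · exact absurd ⟨(one_lt_sq_iff₀ (w.nonneg β)).1 (hc.trans hlt), hlt⟩ h₀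
    · exact heq
    · have hfβ : w (β ^ 2 + c) = w c := hw.add_eq_right_of_lt (by simpa using hgt)
      exact absurd ⟨by rwa [hfβ], by rw [hfβ]; nlinarith⟩ h₁
  · rintro hc β ⟨n, m, hmn, h⟩
    by_contra! hβ
    exact hw.iterate_notMem_escapeRegion hmn h 0
      ⟨hβ, hc.trans_lt (one_lt_pow₀ hβ two_ne_zero)⟩
end

section
/- Let c ∈ ℤ with c ∉ {0, −1, −2} (so that 0 is not preperiodic for f_c). Then the limit L := lim_{n→∞} 2^{-n}·log max(1, |f_c^n(0)|) exists (real absolute value) and satisfies L ≥ (1/4)·log max(1, |c|). Moreover, in the case c = 1 the limit satisfies L ≥ (1/4)·log 2. -/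
/-- If `1 ≤ c` or `c ≤ -3`, the critical orbit of `z ^ 2 + c` grows at least like
`(max 2 |c|) ^ (2 ^ n)`, starting from its second iterate. -/
theorem max_two_abs_pow_le_iterate {c : ℝ} (hc : 1 ≤ c ∨ c ≤ -3) (n : ℕ) :
    (max 2 |c|) ^ (2 ^ n) ≤ (fun x : ℝ => x ^ 2 + c)^[n + 2] 0 := by
  rcases hc with hc | hc
  · rw [abs_of_pos (by linarith)]
    induction n with
    | zero =>
      simp only [pow_zero, pow_one, zero_add, Function.iterate_succ_apply, Function.iterate_zero_apply]
      exact max_le (by nlinarith) (by nlinarith)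
    | succ n ih =>
      rw [show n + 1 + 2 = (n + 2) + 1 by ring, Function.iterate_succ_apply', pow_succ, pow_mul]
      have := pow_le_pow_left₀ (by positivity) ih 2
      linarith
  · rw [abs_of_neg (by linarith), max_eq_right (by linarith)]
    suffices h : (-c) ^ (2 ^ n) + 1 ≤ (fun x : ℝ => x ^ 2 + c)^[n + 2] 0 by linarith
    induction n with
    | zero =>
      simp only [pow_zero, pow_one, zero_add, Function.iterate_succ_apply, Function.iterate_zero_apply]
      nlinarith
    | succ n ih =>
      rw [show n + 1 + 2 = (n + 2) + 1 by ring, Function.iterate_succ_apply', pow_succ, pow_mul]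
      have hle : -c ≤ (-c) ^ (2 ^ n) := le_self_pow₀ (by linarith) (by positivity)
      have := pow_le_pow_left₀ (by linarith) ih 2
      linarith

/-- Squaring approximates `z ^ 2 + c` up to a factor of two away from the filled Julia set. -/
theorem abs_two_mul_log_sub_log_sq_add_le {c x : ℝ} (hx : 2 ≤ x) (hcx : |c| ≤ x) :
    |2 * Real.log x - Real.log (x ^ 2 + c)| ≤ Real.log 2 := by
  obtain ⟨hl, hu⟩ := abs_le.mp hcx
  have hx0 : 0 < x := by linarith
  have hpos : 0 < x ^ 2 + c := by nlinarith
  have hlog : Real.log (x ^ 2) = 2 * Real.log x := by simp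
  have hupper := Real.log_le_log hpos (show x ^ 2 + c ≤ 2 * x ^ 2 by nlinarith)
  have hlower := Real.log_le_log (by positivity) (show x ^ 2 ≤ 2 * (x ^ 2 + c) by nlinarith)
  rw [Real.log_mul two_ne_zero (by positivity), hlog] at hupper
  rw [Real.log_mul two_ne_zero hpos.ne', hlog] at hlower
  exact abs_le.mpr ⟨by linarith, by linarith⟩

open Filter Topology

/-- For `c ∈ ℤ`, `c ∉ {0, -1, -2}`, the canonical height
`L = lim 2^{-n}·log max(1, |f_c^n(0)|)` exists and satisfies `L ≥ (1/4)·log max(1,|c|)`;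
moreover if `c = 1` then `L ≥ (1/4)·log 2`. -/
theorem stmt_2 (c : ℤ) (h0 : c ≠ 0) (h1 : c ≠ -1) (h2 : c ≠ -2) :
    ∃ L : ℝ,
      Tendsto
        (fun n : ℕ =>
          Real.log (max 1 |(fun x : ℝ => x ^ 2 + (c : ℝ))^[n] 0|) / 2 ^ n)
        atTop (nhds L) ∧
      (1 / 4) * Real.log (max 1 |(c : ℝ)|) ≤ L ∧
      (c = 1 → (1 / 4) * Real.log 2 ≤ L) := by
  have hc : 1 ≤ (c : ℝ) ∨ (c : ℝ) ≤ -3 := by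
    have : 1 ≤ c ∨ c ≤ -3 := by omega
    exact_mod_cast this
  set B : ℝ := max 2 |(c : ℝ)| with hB
  have hB2 : 2 ≤ B := le_max_left _ _
  have hBc : |(c : ℝ)| ≤ B := le_max_right _ _
  set x : ℕ → ℝ := fun n => (fun x : ℝ => x ^ 2 + (c : ℝ))^[n] 0 with hx
  have hpow (n : ℕ) : B ^ (2 ^ n) ≤ x (n + 2) := max_two_abs_pow_le_iterate hc n
  have hBx (n : ℕ) : B ≤ x (n + 2) :=
    (le_self_pow₀ (by linarith) (by positivity)).trans (hpow n)
  have hmax (n : ℕ) : max 1 |x (n + 2)| = x (n + 2) := by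
    have := hBx n
    rw [abs_of_pos (by linarith), max_eq_right (by linarith)]
  have hsucc (n : ℕ) : x (n + 1) = x n ^ 2 + c := Function.iterate_succ_apply' _ _ _
  have hcauchy : CauchySeq fun n : ℕ => Real.log (x (n + 2)) / 2 ^ (n + 2) := by
    refine cauchySeq_of_le_geometric_two (C := Real.log 2) fun n => ?_
    have hstep := abs_two_mul_log_sub_log_sq_add_le (hB2.trans (hBx n)) (hBc.trans (hBx n))
    rw [← hsucc] at hstep
    rw [Real.dist_eq, show Real.log (x (n + 2)) / 2 ^ (n + 2) -
        Real.log (x (n + 1 + 2)) / 2 ^ (n + 1 + 2) =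
        (2 * Real.log (x (n + 2)) - Real.log (x (n + 2 + 1))) / (8 * 2 ^ n) by
      rw [show n + 1 + 2 = n + 2 + 1 by ring]; field_simp; ring,
      abs_div, abs_of_pos (show (0 : ℝ) < 8 * 2 ^ n by positivity), div_div]
    have := Real.log_nonneg one_le_two
    gcongr
    norm_num
  obtain ⟨L, hL⟩ := cauchySeq_tendsto_of_complete hcauchy
  have hLB : 1 / 4 * Real.log B ≤ L := by
    refine ge_of_tendsto' hL fun n => ?_
    have h := Real.log_le_log (by positivity) (hpow n)
    rw [Real.log_pow] at h
    push_cast at h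
    rw [le_div_iff₀ (by positivity)]
    calc 1 / 4 * Real.log B * 2 ^ (n + 2) = 2 ^ n * Real.log B := by ring
      _ ≤ _ := h
  refine ⟨L, ?_, ?_, fun _ => ?_⟩
  · rw [← tendsto_add_atTop_iff_nat 2]
    refine hL.congr fun n => ?_
    change _ = Real.log (max 1 |x (n + 2)|) / 2 ^ (n + 2)
    rw [hmax]
  · refine le_trans ?_ hLB
    gcongr
    exact max_le (by linarith) hBc
  · refine le_trans ?_ hLB
    gcongr
end

section
/- Let p be a prime, and let K be a field of characteristic 0 equipped with a nonarchimedean absolute value |·| such that |q| equals the p-adic absolute value of q for every rational number q (viewed in K). Let z ∈ K. (i) If |z − 1| < |p|^{1/(p−1)}, then |z^n − 1| = |z − 1| for every positive integer n not divisible by p, and |z^p − 1| = |p|·|z − 1|. (ii) If |z − 1| > |p|^{1/(p−1)}, then |z^p − 1| = |z − 1|^p. -/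
theorem pow_sub_one_eq_sum_choose {R : Type*} [CommRing R] (z : R) (n : ℕ) :
    z ^ n - 1 = ∑ k ∈ Finset.Icc 1 n, (n.choose k : R) * (z - 1) ^ k := by
  have h : z ^ n = ∑ k ∈ Finset.range (n + 1), (n.choose k : R) * (z - 1) ^ k := by
    conv_lhs => rw [← sub_add_cancel z 1, add_pow]
    exact Finset.sum_congr rfl fun k _ => by ring
  rw [h, Finset.sum_range_eq_add_Ico _ n.succ_pos, ← Finset.Ico_add_one_right_eq_Icc]
  simp

theorem AbsoluteValue.map_natCast_eq_padicNorm {p : ℕ} {K : Type*} [Field K]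
    {f : AbsoluteValue K ℝ} (hres : ∀ q : ℚ, f (q : K) = (padicNorm p q : ℝ)) (n : ℕ) :
    f (n : K) = (padicNorm p n : ℝ) := by
  simpa using hres n

section

variable {K : Type*} [Field K] {f : AbsoluteValue K ℝ}

theorem AbsoluteValue.map_choose_le {p : ℕ} (hp : p.Prime) (hf : IsNonarchimedean f) {k : ℕ}
    (h0 : k ≠ 0) (hk : k < p) : f (p.choose k : K) ≤ f (p : K) := by
  obtain ⟨m, hm⟩ := hp.dvd_choose_self h0 hk
  rw [hm, Nat.cast_mul, map_mul]
  exact mul_le_of_le_one_right (f.nonneg _) (IsNonarchimedean.apply_natCast_le_one hf)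

theorem AbsoluteValue.map_pow_sub_one_eq {z : K} {n m : ℕ} (hf : IsNonarchimedean f)
    (hm : m ∈ Finset.Icc 1 n)
    (hdom : ∀ k ∈ Finset.Icc 1 n, k ≠ m →
      f (n.choose k : K) * f (z - 1) ^ k < f (n.choose m : K) * f (z - 1) ^ m) :
    f (z ^ n - 1) = f (n.choose m : K) * f (z - 1) ^ m := by
  rw [pow_sub_one_eq_sum_choose, hf.apply_sum_eq_of_lt (fun a => (map_neg_eq_map f a).symm) hm]
  · simp
  · simpa using hdom

theorem AbsoluteValue.map_pow_sub_one_of_map_natCast_eq_one {z : K} {n : ℕ}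
    (hf : IsNonarchimedean f) (hn : 0 < n) (hfn : f (n : K) = 1) (hz : f (z - 1) < 1) :
    f (z ^ n - 1) = f (z - 1) := by
  rcases eq_or_ne (z - 1) 0 with h0 | h0
  · simp [sub_eq_zero.mp h0]
  have ha : 0 < f (z - 1) := f.pos h0
  rw [map_pow_sub_one_eq hf (m := 1) (Finset.mem_Icc.mpr ⟨le_rfl, hn⟩)]
  · simp [hfn]
  · intro k hk hk1
    rw [Nat.choose_one_right, hfn, one_mul]
    have : 1 < k := by have := (Finset.mem_Icc.mp hk).1; omega
    exact (mul_le_of_le_one_left (by positivity)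
      (IsNonarchimedean.apply_natCast_le_one hf)).trans_lt
      (pow_lt_pow_right_of_lt_one₀ ha hz this)

theorem AbsoluteValue.map_pow_prime_sub_one_of_lt {z : K} {p : ℕ} (hp : p.Prime)
    (hf : IsNonarchimedean f) (hz : f (z - 1) < 1) (h : f (z - 1) ^ (p - 1) < f (p : K)) :
    f (z ^ p - 1) = f (p : K) * f (z - 1) := by
  rcases eq_or_ne (z - 1) 0 with h0 | h0
  · simp [sub_eq_zero.mp h0]
  have ha : 0 < f (z - 1) := f.pos h0
  have hfp : 0 < f (p : K) := (pow_pos ha _).trans h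
  rw [map_pow_sub_one_eq hf (m := 1) (Finset.mem_Icc.mpr ⟨le_rfl, hp.one_le⟩)]
  · simp
  · intro k hk hk1
    rw [Nat.choose_one_right, pow_one]
    obtain ⟨hk0, hkp⟩ := Finset.mem_Icc.mp hk
    rcases hkp.lt_or_eq with hlt | rfl
    · calc f (p.choose k : K) * f (z - 1) ^ k ≤ f (p : K) * f (z - 1) ^ k := by
            gcongr
            exact map_choose_le hp hf (by omega) hlt
        _ < f (p : K) * f (z - 1) := by
            gcongr
            exact pow_lt_self_of_lt_one₀ ha hz (by omega)
    · rw [Nat.choose_self, Nat.cast_one, map_one, one_mul, ← pow_sub_one_mul hp.ne_zero]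
      gcongr

theorem AbsoluteValue.map_pow_prime_sub_one_of_gt {z : K} {p : ℕ} (hp : p.Prime)
    (hf : IsNonarchimedean f) (hp1 : f (p : K) < 1) (h : f (p : K) < f (z - 1) ^ (p - 1)) :
    f (z ^ p - 1) = f (z - 1) ^ p := by
  have ha : 0 < f (z - 1) := (f.nonneg _).lt_of_ne fun h0 => by
    rw [← h0, zero_pow (by have := hp.two_le; omega)] at h
    exact h.not_ge (f.nonneg _)
  rw [map_pow_sub_one_eq hf (m := p) (Finset.mem_Icc.mpr ⟨hp.one_le, le_rfl⟩)]
  · simp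
  · intro k hk hkne
    obtain ⟨hk0, hkp⟩ := Finset.mem_Icc.mp hk
    have hlt : k < p := lt_of_le_of_ne hkp hkne
    rw [Nat.choose_self, Nat.cast_one, map_one, one_mul]
    have key : f (p : K) < f (z - 1) ^ (p - k) := by
      rcases le_total (f (z - 1)) 1 with h1 | h1
      · exact h.trans_le (pow_le_pow_of_le_one ha.le h1 (by omega))
      · exact hp1.trans_le (one_le_pow₀ h1)
    calc f (p.choose k : K) * f (z - 1) ^ k ≤ f (p : K) * f (z - 1) ^ k := by
          gcongr
          exact map_choose_le hp hf (by omega) hlt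
      _ < f (z - 1) ^ (p - k) * f (z - 1) ^ k := by gcongr
      _ = f (z - 1) ^ p := pow_sub_mul_pow _ hkp

end


/-- Let `p` be prime and `K` a characteristic-zero field with a
nonarchimedean absolute value restricting to the `p`-adic absolute value on `ℚ`.  For `z ∈ K`:
(i) if `|z − 1| < |p|^{1/(p−1)}`, then `|z^n − 1| = |z − 1|` for every positive `n` not
divisible by `p`, and `|z^p − 1| = |p|·|z − 1|`;
(ii) if `|z − 1| > |p|^{1/(p−1)}`, then `|z^p − 1| = |z − 1|^p`. -/
theorem stmt_11 (p : ℕ) (hp : p.Prime) {K : Type*} [Field K] [CharZero K]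
    (v : K → ℝ)
    (hnonneg : ∀ x, 0 ≤ v x) (heq0 : ∀ x, v x = 0 ↔ x = 0)
    (hmul : ∀ x y, v (x * y) = v x * v y)
    (hna : ∀ x y, v (x + y) ≤ max (v x) (v y))
    (hres : ∀ q : ℚ, v ((q : K)) = (padicNorm p q : ℝ))
    (z : K) :
    (v (z - 1) < v ((p : K)) ^ ((1 : ℝ) / ((p : ℝ) - 1)) →
      (∀ n : ℕ, 0 < n → ¬ p ∣ n → v (z ^ n - 1) = v (z - 1)) ∧
      v (z ^ p - 1) = v ((p : K)) * v (z - 1)) ∧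
    (v ((p : K)) ^ ((1 : ℝ) / ((p : ℝ) - 1)) < v (z - 1) →
      v (z ^ p - 1) = v (z - 1) ^ p) := by
  let f : AbsoluteValue K ℝ :=
    { toFun := v
      map_mul' := hmul
      nonneg' := hnonneg
      eq_zero' := heq0
      add_le' := fun x y => IsNonarchimedean.add_le hnonneg hna }
  have hf : IsNonarchimedean f := hna
  have : Fact p.Prime := ⟨hp⟩
  have hcast : ∀ n : ℕ, f (n : K) = (padicNorm p n : ℝ) :=
    AbsoluteValue.map_natCast_eq_padicNorm (f := f) hres
  have hp1 : f (p : K) < 1 := by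
    rw [hcast]
    exact_mod_cast padicNorm.padicNorm_p_lt_one_of_prime
  have hexp : (1 : ℝ) / ((p : ℝ) - 1) = ((p - 1 : ℕ) : ℝ)⁻¹ := by
    rw [Nat.cast_sub hp.one_le, Nat.cast_one, one_div]
  have hpos : (0 : ℝ) < ((p - 1 : ℕ) : ℝ) := by
    exact_mod_cast Nat.sub_pos_of_lt hp.one_lt
  change (f (z - 1) < f (p : K) ^ _ → (∀ n : ℕ, 0 < n → ¬ p ∣ n → f (z ^ n - 1) = f (z - 1)) ∧
    f (z ^ p - 1) = f (p : K) * f (z - 1)) ∧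
    (f (p : K) ^ _ < f (z - 1) → f (z ^ p - 1) = f (z - 1) ^ p)
  rw [hexp, Real.lt_rpow_inv_iff_of_pos (f.nonneg _) (f.nonneg _) hpos,
    Real.rpow_inv_lt_iff_of_pos (f.nonneg _) (f.nonneg _) hpos, Real.rpow_natCast]
  refine ⟨fun h => ?_, AbsoluteValue.map_pow_prime_sub_one_of_gt hp hf hp1⟩
  have hz : f (z - 1) < 1 := lt_of_pow_lt_pow_left₀ (p - 1) zero_le_one (by
    simpa using h.trans hp1)
  refine ⟨fun n hn hpn => ?_, AbsoluteValue.map_pow_prime_sub_one_of_lt hp hf hz h⟩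
  refine AbsoluteValue.map_pow_sub_one_of_map_natCast_eq_one hf hn ?_ hz
  rw [hcast, (padicNorm.nat_eq_one_iff n).mpr hpn, Rat.cast_one]
end

section
/- Let K be a field equipped with a nonarchimedean absolute value |·|, and let f = a₀ + a₁X + ⋯ + a_d X^d ∈ K[X] with d ≥ 2, |a_i| ≤ 1 for all i, and |a_d| = 1. Let α ∈ K with |α| ≤ 1, and let n > m ≥ 0 be integers such that |f^{∘n}(α) − f^{∘m}(α)| = 1. Then every β ∈ K with f^{∘n}(β) = f^{∘m}(β) satisfies |β − α| ≥ 1. -/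
open Polynomial in
/-- A polynomial with coefficients in the unit ball of a nonarchimedean absolute value maps the
unit ball to itself and is `1`-Lipschitz there. -/
theorem eval_le_one_and_eval_sub_le_of_coeff_le_one {K : Type*} [Field K] (w : AbsoluteValue K ℝ)
    (hna : ∀ x y, w (x + y) ≤ max (w x) (w y)) (f : K[X]) (hcoeff : ∀ i, w (f.coeff i) ≤ 1)
    {x y : K} (hx : w x ≤ 1) (hy : w y ≤ 1) :
    w (f.eval x) ≤ 1 ∧ w (f.eval x - f.eval y) ≤ w (x - y) := by
  let O : Subring K :=
    { carrier := {z | w z ≤ 1}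
      mul_mem' := fun {a b} ha hb => by
        simpa using mul_le_one₀ (show w a ≤ 1 from ha) (w.nonneg b) hb
      one_mem' := by simp
      add_mem' := fun {a b} ha hb => (hna a b).trans (max_le ha hb)
      zero_mem' := by simp
      neg_mem' := fun {a} ha => by simpa using ha }
  have hf : (f.coeffs : Set K) ⊆ O := by
    intro c hc
    obtain ⟨i, -, rfl⟩ := mem_coeffs_iff.1 hc
    exact hcoeff i
  have key (z : O) : O.subtype ((f.toSubring O hf).eval z) = f.eval (z : K) := by
    rw [← eval₂_at_apply, ← eval_map, map_toSubring]
    rfl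
  obtain ⟨c, hc⟩ := sub_dvd_eval_sub (⟨x, hx⟩ : O) ⟨y, hy⟩ (f.toSubring O hf)
  have hc' := congrArg O.subtype hc
  rw [map_sub, map_mul, map_sub, key, key] at hc'
  refine ⟨?_, ?_⟩
  · rw [← key ⟨x, hx⟩]
    exact ((f.toSubring O hf).eval ⟨x, hx⟩).2
  · rw [show f.eval x - f.eval y = (x - y) * c from hc', map_mul]
    exact mul_le_of_le_one_right (w.nonneg _) c.2

open Polynomial in
/-- Iterates of a polynomial with coefficients in the unit ball are `1`-Lipschitz on it. -/
theorem iterate_eval_sub_le_of_coeff_le_one {K : Type*} [Field K] (w : AbsoluteValue K ℝ)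
    (hna : ∀ x y, w (x + y) ≤ max (w x) (w y)) (f : K[X]) (hcoeff : ∀ i, w (f.coeff i) ≤ 1)
    (k : ℕ) {x y : K} (hx : w x ≤ 1) (hy : w y ≤ 1) :
    w ((fun z => f.eval z)^[k] x - (fun z => f.eval z)^[k] y) ≤ w (x - y) := by
  induction k generalizing x y with
  | zero => simp
  | succ k ih =>
    obtain ⟨h₁, h₂⟩ := eval_le_one_and_eval_sub_le_of_coeff_le_one w hna f hcoeff hx hy
    exact (ih h₁ (eval_le_one_and_eval_sub_le_of_coeff_le_one w hna f hcoeff hy hx).1).trans h₂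

/-- Over a field with a nonarchimedean absolute value, let
`f = a₀ + a₁X + ⋯ + a_d X^d` with `d ≥ 2`, `|aᵢ| ≤ 1` for all `i` and `|a_d| = 1`.
If `|α| ≤ 1` and `|f^{∘n}(α) − f^{∘m}(α)| = 1` for some `n > m ≥ 0`, then every root `β`
of `f^{∘n} − f^{∘m}` satisfies `|β − α| ≥ 1`. -/
theorem stmt_13 {K : Type*} [Field K] (v : K → ℝ)
    (hnonneg : ∀ x, 0 ≤ v x) (heq0 : ∀ x, v x = 0 ↔ x = 0)
    (hmul : ∀ x y, v (x * y) = v x * v y)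
    (hna : ∀ x y, v (x + y) ≤ max (v x) (v y))
    (f : Polynomial K) (d : ℕ) (hd : 2 ≤ d) (hdeg : f.natDegree = d)
    (hcoeff : ∀ i, v (f.coeff i) ≤ 1) (hlead : v (f.coeff d) = 1)
    (α : K) (hα : v α ≤ 1) (n m : ℕ) (hmn : m < n)
    (hunit : v ((fun z => f.eval z)^[n] α - (fun z => f.eval z)^[m] α) = 1) :
    ∀ β : K, (fun z => f.eval z)^[n] β = (fun z => f.eval z)^[m] β → 1 ≤ v (β - α) := by
  intro β hβ
  let w : AbsoluteValue K ℝ :=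
    { toFun := v
      map_mul' := hmul
      nonneg' := hnonneg
      eq_zero' := heq0
      add_le' := fun x y => (hna x y).trans (max_le_add_of_nonneg (hnonneg x) (hnonneg y)) }
  change 1 ≤ w (β - α)
  by_contra! hlt
  have hβ₁ : w β ≤ 1 := by
    have h : w (β - α + α) ≤ max (w (β - α)) (w α) := hna _ _
    rw [sub_add_cancel] at h
    exact h.trans (max_le hlt.le hα)
  have hn := iterate_eval_sub_le_of_coeff_le_one w hna f hcoeff n hα hβ₁
  have hm := iterate_eval_sub_le_of_coeff_le_one w hna f hcoeff m hβ₁ hα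
  rw [w.map_sub α β] at hn
  have h := hna _ _ |>.trans_lt (max_lt (hn.trans_lt hlt) (hm.trans_lt hlt))
  rw [hβ, sub_add_sub_cancel, hunit] at h
  exact lt_irrefl _ h
end

section
/- Let f ∈ ℂ[X] be a polynomial of degree d ≥ 2 and let n > m ≥ 0 be integers. Then the polynomial f^{∘n} − f^{∘m} is nonzero and has at least max( n , max(1, n − m − 2)·max(1, d^{m−1}) ) distinct roots in ℂ. -/
open Polynomial

section DistinctRoots

open UniqueFactorizationMonoid EuclideanDomain

variable {K : Type*} [Field K]

theorem comp_ne_zero_of_natDegree_pos {p g : K[X]} (hp : p ≠ 0)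
    (hg : 0 < g.natDegree) : p.comp g ≠ 0 := by
  rw [Ne, comp_eq_zero_iff, not_or, not_and]
  exact ⟨hp, fun _ hC => by rw [hC, natDegree_C] at hg; exact hg.false⟩

theorem wronskian_ne_zero_of_natDegree_ne [CharZero K] {a b : K[X]}
    (ha : a ≠ 0) (hb : b ≠ 0) (h : a.natDegree ≠ b.natDegree) : wronskian a b ≠ 0 := by
  intro hw
  have hlc := congrArg leadingCoeff (sub_eq_zero.1 hw)
  simp only [leadingCoeff_mul, leadingCoeff_derivative] at hlc
  have ha' := leadingCoeff_ne_zero.2 ha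
  have hb' := leadingCoeff_ne_zero.2 hb
  have : (b.natDegree : K) = a.natDegree := by
    apply mul_left_cancel₀ (mul_ne_zero ha' hb')
    linear_combination hlc
  exact h (by exact_mod_cast this.symm)

variable [DecidableEq K]

theorem isRoot_radical_iff {p : K[X]} (hp : p ≠ 0) {x : K} :
    (radical p).IsRoot x ↔ p.IsRoot x := by
  rw [← dvd_iff_isRoot, ← dvd_iff_isRoot,
    dvd_radical_iff_of_irreducible (irreducible_X_sub_C x) hp]

theorem toFinset_roots_radical (p : K[X]) :
    (radical p).roots.toFinset = p.roots.toFinset := by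
  rcases eq_or_ne p 0 with rfl | hp
  · simp
  · ext x
    simp only [Multiset.mem_toFinset, mem_roots hp, mem_roots (radical_ne_zero (a := p)),
      isRoot_radical_iff hp]

theorem card_roots_toFinset_le_of_dvd {p q : K[X]}
    (h : p ∣ q) (hq : q ≠ 0) : p.roots.toFinset.card ≤ q.roots.toFinset.card :=
  Finset.card_le_card (Multiset.toFinset_subset.2 (Multiset.subset_of_le (roots.le_of_dvd hq h)))

theorem natDegree_divRadical_add_natDegree_radical {p : K[X]} (hp : p ≠ 0) :
    (divRadical p).natDegree + (radical p).natDegree = p.natDegree := by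
  rw [← natDegree_mul (divRadical_ne_zero hp) radical_ne_zero, divRadical_mul_radical]

theorem natDegree_radical_eq_card_roots [IsAlgClosed K] [CharZero K] (p : K[X]) :
    (radical p).natDegree = p.roots.toFinset.card := by
  have hsep : (radical p).Separable :=
    PerfectField.separable_iff_squarefree.2 squarefree_radical
  rw [← toFinset_roots_radical, Multiset.toFinset_card_of_nodup (nodup_roots hsep),
    (IsAlgClosed.splits (radical p)).natDegree_eq_card_roots]

theorem natDegree_divRadical_add_card_roots [IsAlgClosed K] [CharZero K] {p : K[X]} (hp : p ≠ 0) :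
    (divRadical p).natDegree + p.roots.toFinset.card = p.natDegree := by
  rw [← natDegree_radical_eq_card_roots, natDegree_divRadical_add_natDegree_radical hp]

/-- A polynomial with fewer distinct roots than its degree has a multiple root. -/
theorem exists_isRoot_derivative_of_card_roots_lt [IsAlgClosed K] [CharZero K] {p : K[X]}
    (h : p.roots.toFinset.card < p.natDegree) :
    ∃ x, p.IsRoot x ∧ (derivative p).IsRoot x := by
  have hp : p ≠ 0 := by rintro rfl; simp at h
  have hdeg := natDegree_divRadical_add_card_roots hp
  obtain ⟨x, hx⟩ := IsAlgClosed.exists_root (divRadical p)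
    (by rw [degree_eq_natDegree (divRadical_ne_zero hp)]; exact_mod_cast (by omega))
  exact ⟨x, hx.dvd (divRadical_dvd_self p), hx.dvd (divRadical_dvd_derivative p)⟩

theorem toFinset_roots_radical_comp {p g : K[X]}
    (hp : p ≠ 0) (hg : 0 < g.natDegree) :
    ((radical p).comp g).roots.toFinset = (p.comp g).roots.toFinset := by
  ext x
  have h := isRoot_radical_iff hp (x := g.eval x)
  simpa [mem_roots, comp_ne_zero_of_natDegree_pos hp hg,
    comp_ne_zero_of_natDegree_pos (radical_ne_zero (a := p)) hg, eval_comp] using h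

theorem card_roots_comp_le [IsAlgClosed K] [CharZero K] {p g : K[X]} (hp : p ≠ 0)
    (hg : 0 < g.natDegree) :
    (p.comp g).roots.toFinset.card ≤ p.roots.toFinset.card * g.natDegree := by
  rw [← toFinset_roots_radical_comp hp hg, ← natDegree_radical_eq_card_roots p, ← natDegree_comp]
  exact (Multiset.toFinset_card_le _).trans (card_roots' _)

/-- Riemann–Hurwitz for a polynomial map: a degree `e` polynomial takes the values in a set of
`s` points on at least `(s - 1) e + 1` points. -/
theorem card_roots_mul_natDegree_lt [IsAlgClosed K] [CharZero K] {p g : K[X]} (hp : p ≠ 0)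
    (hg : 0 < g.natDegree) :
    p.roots.toFinset.card * g.natDegree < (p.comp g).roots.toFinset.card + g.natDegree := by
  rw [← toFinset_roots_radical_comp hp hg, ← natDegree_radical_eq_card_roots, ← natDegree_comp]
  set P := (radical p).comp g with hP
  have hP0 : P ≠ 0 := comp_ne_zero_of_natDegree_pos radical_ne_zero hg
  have hsep : (radical p).Separable :=
    PerfectField.separable_iff_squarefree.2 squarefree_radical
  have hcop : IsCoprime P ((derivative (radical p)).comp g) := by
    simpa [hP] using IsCoprime.map hsep (compRingHom g)
  have hdvd : divRadical P ∣ derivative g := by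
    have h := divRadical_dvd_derivative P
    rw [hP, derivative_comp, ← hP] at h
    exact (hcop.of_isCoprime_of_dvd_left (divRadical_dvd_self P)).dvd_of_dvd_mul_right h
  have hg' : derivative g ≠ 0 := fun h => hg.ne' (derivative_eq_zero.1 h)
  have h1 := natDegree_le_of_dvd hdvd hg'
  have h2 := natDegree_derivative_lt hg.ne'
  have h3 := natDegree_divRadical_add_card_roots hP0
  omega

/-- If `F` commutes with `f` and is critical at the critical points of `f`, then `F` has many
distinct fixed points. -/
theorem natDegree_add_two_le_of_comp_comm [IsAlgClosed K] [CharZero K] {f F : K[X]}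
    (hf : 2 ≤ f.natDegree) (hF : 2 ≤ F.natDegree) (hcomm : f.comp F = F.comp f)
    (hcrit : derivative f ∣ derivative F) :
    F.natDegree + 2 ≤ (F - X).roots.toFinset.card * (f.natDegree + 1) + f.natDegree := by
  set h := F - X with hh
  have hFX : F = X + h := by rw [hh]; ring
  have hdeg : h.natDegree = F.natDegree :=
    natDegree_sub_eq_left_of_natDegree_lt (by rw [natDegree_X]; omega)
  have h0 : h ≠ 0 := by rintro h0; rw [h0, natDegree_zero] at hdeg; omega
  obtain ⟨k, hk⟩ := binomExpansion (f.map C) X h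
  simp only [derivative_map, eval_map, ← comp.eq_1, comp_X, ← hFX] at hk
  set q := derivative f + k * h with hq
  have hcomp : h.comp f = q * h := by
    rw [hh, sub_comp, X_comp, ← hcomm, hk, ← hh, hq]; ring
  have hcomp0 : h.comp f ≠ 0 := comp_ne_zero_of_natDegree_pos h0 (by omega)
  have hq0 : q ≠ 0 := left_ne_zero_of_mul (hcomp ▸ hcomp0)
  have hqdeg : q.natDegree + F.natDegree = F.natDegree * f.natDegree := by
    rw [← hdeg, ← natDegree_mul hq0 h0, ← hcomp, natDegree_comp]
  have hf' : derivative f ≠ 0 := fun h' => by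
    have := derivative_eq_zero.1 h'; omega
  have hf'deg := natDegree_derivative_lt (p := f) (by omega)
  have hlt : (derivative f).natDegree < q.natDegree := by
    nlinarith
  have hcop : IsCoprime (divRadical q) (divRadical h) := by
    refine (isCoprime_iff_aeval_ne_zero_of_isAlgClosed K K _ _).2 fun x => ?_
    by_contra! hx
    simp only [coe_aeval_eq_eval] at hx
    have hqx : q.IsRoot x := IsRoot.dvd hx.1 (divRadical_dvd_self q)
    have hhx : h.IsRoot x := IsRoot.dvd hx.2 (divRadical_dvd_self h)
    have hh'x : (derivative h).IsRoot x := IsRoot.dvd hx.2 (divRadical_dvd_derivative h)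
    have hf'x : (derivative f).IsRoot x := by
      simpa [hq, IsRoot.def, hhx.eq_zero] using hqx
    have hF'x := (hf'x.dvd hcrit).eq_zero
    simp [hh, IsRoot.def, hF'x] at hh'x
  have hdvd : divRadical q * divRadical h ∣ wronskian (derivative f) q := by
    refine hcop.mul_dvd (divRadical_dvd_wronskian_right _ _) ?_
    rw [hq, wronskian_add_right, wronskian_self_eq_zero, zero_add, wronskian,
      derivative_mul]
    have a := divRadical_dvd_self h
    have b := divRadical_dvd_derivative h
    exact dvd_sub (dvd_mul_of_dvd_right (dvd_add (a.mul_left _) (b.mul_left _)) _)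
      (dvd_mul_of_dvd_right (a.mul_left _) _)
  have hw := wronskian_ne_zero_of_natDegree_ne hf' hq0 hlt.ne
  have hle := natDegree_le_of_dvd hdvd hw
  rw [natDegree_mul (divRadical_ne_zero hq0) (divRadical_ne_zero h0)] at hle
  have hwlt := natDegree_wronskian_lt_add hw
  have hqr := natDegree_divRadical_add_card_roots hq0
  have hhr := natDegree_divRadical_add_card_roots h0
  have hle1 : q.roots.toFinset.card ≤ (h.comp f).roots.toFinset.card :=
    card_roots_toFinset_le_of_dvd (hcomp ▸ dvd_mul_right q h) hcomp0
  have hle2 := card_roots_comp_le h0 (g := f) (by omega)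
  rw [mul_add]
  omega

/-- If `f` has degree at least two, then the preimage of its fixed points is not a singleton. -/
theorem two_le_card_roots_sub_X_comp [IsAlgClosed K] [CharZero K] {f : K[X]}
    (hf : 2 ≤ f.natDegree) : 2 ≤ ((f - X).comp f).roots.toFinset.card := by
  have hdeg : (f - X).natDegree = f.natDegree :=
    natDegree_sub_eq_left_of_natDegree_lt (by rw [natDegree_X]; omega)
  have h0 : f - X ≠ 0 := by rintro h0; rw [h0, natDegree_zero] at hdeg; omega
  have hcomp0 : (f - X).comp f ≠ 0 := comp_ne_zero_of_natDegree_pos h0 (by omega)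
  by_contra! hlt
  have hle : (f - X).roots.toFinset.card * f.natDegree < 1 + f.natDegree := by
    have := card_roots_mul_natDegree_lt h0 (g := f) (by omega)
    omega
  obtain ⟨y, hy, hy'⟩ := exists_isRoot_derivative_of_card_roots_lt (p := f - X)
    (by rw [hdeg]; nlinarith)
  have hfy : f.eval y = y := by simpa [sub_eq_zero] using hy
  have hsub : (f - C y).roots.toFinset ⊆ ((f - X).comp f).roots.toFinset := by
    intro z hz
    simp only [Multiset.mem_toFinset, mem_roots', IsRoot.def, eval_sub, eval_C, sub_eq_zero,
      eval_comp, eval_X] at hz ⊢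
    exact ⟨hcomp0, by rw [hz.2, hfy]⟩
  obtain ⟨z, hz, hz'⟩ := exists_isRoot_derivative_of_card_roots_lt (p := f - C y)
    (by rw [natDegree_sub_C]; exact (Finset.card_le_card hsub).trans_lt (by omega))
  have hfz : f.eval z = y := by simpa [sub_eq_zero] using hz
  have hyz : y = z := Finset.card_le_one.1 (Nat.le_of_lt_succ hlt) y
    (by
      rw [Multiset.mem_toFinset, mem_roots hcomp0]
      simp [hfy]) z (by
      rw [Multiset.mem_toFinset, mem_roots hcomp0]
      simp [hfy, hfz])
  subst hyz
  simp_all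

end DistinctRoots

section Iterate

variable {R : Type*} [CommRing R]

theorem iterate_comp_eq_comp_iterate (f q : R[X]) (n : ℕ) :
    (fun q : R[X] => q.comp f)^[n] q = q.comp ((fun q : R[X] => q.comp f)^[n] X) := by
  induction n with
  | zero => simp
  | succ n ih => rw [Function.iterate_succ_apply', Function.iterate_succ_apply', ih, comp_assoc]

theorem natDegree_iterate_comp_X [IsDomain R] (f : R[X]) (n : ℕ) :
    ((fun q : R[X] => q.comp f)^[n] X).natDegree = f.natDegree ^ n := by
  induction n with
  | zero => simp
  | succ n ih => rw [Function.iterate_succ_apply', natDegree_comp, ih, pow_succ]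

theorem comp_iterate_comp_X_comm (f : R[X]) (n : ℕ) :
    f.comp ((fun q : R[X] => q.comp f)^[n] X) = ((fun q : R[X] => q.comp f)^[n] X).comp f := by
  rw [← iterate_comp_eq_comp_iterate, ← Function.iterate_succ_apply' (fun q : R[X] => q.comp f),
    Function.iterate_succ_apply, X_comp]

theorem iterate_comp_X_sub_iterate_comp_X (f : R[X]) (k m : ℕ) :
    (fun q : R[X] => q.comp f)^[k + m] X - (fun q : R[X] => q.comp f)^[m] X =
      ((fun q : R[X] => q.comp f)^[k] X - X).comp ((fun q : R[X] => q.comp f)^[m] X) := by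
  rw [sub_comp, X_comp, ← iterate_comp_eq_comp_iterate, ← Function.iterate_add_apply,
    Nat.add_comm k m]

end Iterate

theorem le_card_roots_iterate_comp_X_sub_X {K : Type*} [Field K] [IsAlgClosed K] [CharZero K]
    [DecidableEq K] {f : K[X]} (hf : 2 ≤ f.natDegree) {k : ℕ} (hk : 2 ≤ k) :
    k ≤ ((fun q : K[X] => q.comp f)^[k] X - X).roots.toFinset.card := by
  have hdeg := natDegree_iterate_comp_X f k
  have hcrit : derivative f ∣ derivative ((fun q : K[X] => q.comp f)^[k] X) := by
    obtain ⟨j, rfl⟩ : ∃ j, k = j + 1 := ⟨k - 1, by omega⟩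
    rw [Function.iterate_succ_apply', derivative_comp]
    exact dvd_mul_right _ _
  have hbound : k * (f.natDegree + 1) ≤ f.natDegree ^ k + 2 := by
    clear hdeg hcrit
    induction k, hk using Nat.le_induction with
    | base => nlinarith
    | succ k hk ih =>
      have : f.natDegree ^ 2 ≤ f.natDegree ^ k := Nat.pow_le_pow_right (by omega) hk
      rw [pow_succ]
      nlinarith
  have hdeg2 : 2 ≤ f.natDegree ^ k := hf.trans (Nat.le_self_pow (by omega) _)
  have h := natDegree_add_two_le_of_comp_comm hf (hdeg ▸ hdeg2)
    (comp_iterate_comp_X_comm f k) hcrit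
  by_contra! hlt
  have : (((fun q : K[X] => q.comp f)^[k] X - X).roots.toFinset.card + 1) * (f.natDegree + 1) ≤
    k * (f.natDegree + 1) := Nat.mul_le_mul_right _ hlt
  rw [hdeg] at h
  nlinarith

/-- For a complex polynomial `f` of degree `d ≥ 2` and integers
`n > m ≥ 0`, the polynomial `f^{∘n} − f^{∘m}` is nonzero and has at least
`max(n, max(1, n − m − 2)·max(1, d^{m−1}))` distinct roots in `ℂ` (here subtraction of
naturals is truncated, matching the conventions `max(1, n−m−2)` and `max(1, d^{m−1})`,
with `d^{m-1}` read as `1` when `m = 0`). -/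
theorem stmt_15 (f : Polynomial ℂ) (d : ℕ) (hd : 2 ≤ d) (hdeg : f.natDegree = d)
    (n m : ℕ) (hmn : m < n) :
    (fun q => q.comp f)^[n] X - (fun q => q.comp f)^[m] X ≠ 0 ∧
    max n (max 1 (n - m - 2) * max 1 (d ^ (m - 1))) ≤
      ((fun q => q.comp f)^[n] X - (fun q => q.comp f)^[m] X).roots.toFinset.card := by
  subst hdeg
  obtain ⟨k, rfl⟩ : ∃ k, n = k + m := ⟨n - m, by omega⟩
  have hk : 1 ≤ k := by omega
  have hk2 : 2 ≤ f.natDegree ^ k := hd.trans (Nat.le_self_pow (by omega) _)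
  have hm : 0 < ((fun q : ℂ[X] => q.comp f)^[m] X).natDegree := by
    rw [natDegree_iterate_comp_X]; positivity
  have hdeg : ((fun q : ℂ[X] => q.comp f)^[k] X - X).natDegree = f.natDegree ^ k := by
    rw [natDegree_sub_eq_left_of_natDegree_lt] <;> rw [natDegree_iterate_comp_X]
    rw [natDegree_X]; omega
  have h0 : (fun q : ℂ[X] => q.comp f)^[k] X - X ≠ 0 := by
    rintro h0; rw [h0, natDegree_zero] at hdeg; omega
  rw [iterate_comp_X_sub_iterate_comp_X, Nat.add_sub_cancel]
  have hcomp0 := comp_ne_zero_of_natDegree_pos h0 hm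
  refine ⟨hcomp0, ?_⟩
  rw [max_eq_right (Nat.one_le_pow _ _ (by omega) : 1 ≤ f.natDegree ^ (m - 1))]
  have hlow := card_roots_mul_natDegree_lt h0 hm
  rw [natDegree_iterate_comp_X] at hlow
  rcases hk.eq_or_lt with rfl | hk
  · simp only [Function.iterate_one, X_comp] at *
    have htwo := two_le_card_roots_sub_X_comp hd
    cases m with
    | zero =>
      have hle := htwo.trans (card_roots_comp_le h0 (by omega))
      have hpos : 0 < (f - X).roots.toFinset.card :=
        Nat.pos_of_mul_pos_right (Nat.lt_of_lt_of_le Nat.zero_lt_two hle)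
      simp_all
    | succ j =>
      have hsplit : (f - X).comp ((fun q : ℂ[X] => q.comp f)^[j + 1] X) =
          ((f - X).comp f).comp ((fun q : ℂ[X] => q.comp f)^[j] X) := by
        rw [Function.iterate_succ_apply, X_comp, iterate_comp_eq_comp_iterate f f, comp_assoc]
      have hlow := card_roots_mul_natDegree_lt
        (comp_ne_zero_of_natDegree_pos h0 (by omega : 0 < f.natDegree))
        (g := (fun q : ℂ[X] => q.comp f)^[j] X) (by rw [natDegree_iterate_comp_X]; positivity)
      rw [natDegree_iterate_comp_X, ← hsplit] at hlow
      have hj : j < f.natDegree ^ j := Nat.lt_pow_self hd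
      have := (Nat.mul_le_mul_right (f.natDegree ^ j) htwo).trans_lt hlow
      simp only [Nat.add_sub_cancel, Nat.sub_eq_zero_of_le one_le_two,
        max_eq_left zero_le_one, one_mul]
      omega
  · have hmlt : m < f.natDegree ^ m := Nat.lt_pow_self hd
    have hmono : f.natDegree ^ (m - 1) ≤ f.natDegree ^ m :=
      Nat.pow_le_pow_right (by omega) (by omega)
    have hlow' := (Nat.mul_le_mul_right (f.natDegree ^ m)
      (le_card_roots_iterate_comp_X_sub_X hd hk)).trans_lt hlow
    obtain ⟨j, rfl⟩ : ∃ j, k = j + 2 := ⟨k - 2, by omega⟩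
    have hmul : max 1 j * f.natDegree ^ (m - 1) ≤ (j + 1) * f.natDegree ^ m :=
      Nat.mul_le_mul (by omega) hmono
    rw [Nat.add_sub_cancel]
    refine max_le ?_ ?_ <;> nlinarith
end

section
/- Let S be a finite set of rational primes. There exists a constant C, depending only on S, such that for every c ∈ ℤ with c ∉ {0, −1, −2}, the set { f_c^n(0) − f_c^m(0) : n > m ≥ 0 } ∩ U_S has at most C elements, where U_S is the group of S-units of ℚ, i.e. the set of nonzero rationals q with |q|_p = 1 for every prime p ∉ S. -/
/-- The doubly indexed set of differences `f_c^n(0) − f_c^m(0)`, `n > m ≥ 0`, for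
`f_c(x) = x² + c` over `ℚ`. -/
def diffOrbitSet (c : ℤ) : Set ℚ :=
  { y | ∃ n m : ℕ, m < n ∧
    y = (fun x : ℚ => x ^ 2 + (c : ℚ))^[n] 0 - (fun x : ℚ => x ^ 2 + (c : ℚ))^[m] 0 }

/-- The group of `S`-units of `ℚ`: nonzero rationals `q` with `|q|_p = 1` for every prime
`p ∉ S`. -/
def sUnitsQ (S : Finset ℕ) : Set ℚ :=
  { q | q ≠ 0 ∧ ∀ p : ℕ, p.Prime → p ∉ S → padicNorm p q = 1 }

/-- The critical orbit `f_c^n(0)` of `f_c(x) = x² + c`, as a sequence of integers. -/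
def critOrbit (c : ℤ) (n : ℕ) : ℤ := (fun x : ℤ => x ^ 2 + c)^[n] 0

namespace critOrbit

variable {c : ℤ}

@[simp] lemma zero : critOrbit c 0 = 0 := rfl

lemma succ (n : ℕ) : critOrbit c (n + 1) = critOrbit c n ^ 2 + c := by
  simp [critOrbit, Function.iterate_succ_apply']

@[simp] lemma one : critOrbit c 1 = c := by simp [succ]

lemma intCast_eq (n : ℕ) : (critOrbit c n : ℚ) = (fun x : ℚ => x ^ 2 + (c : ℚ))^[n] 0 := by
  induction n with
  | zero => simp
  | succ n ih => rw [Function.iterate_succ_apply', ← ih, succ]; push_cast; rfl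

/-! ### Growth -/

lemma pos_and_two_mul_le (h0 : c ≠ 0) (h1 : c ≠ -1) (h2 : c ≠ -2) (n : ℕ) :
    0 < critOrbit c (n + 2) ∧ 2 * |critOrbit c (n + 1)| ≤ critOrbit c (n + 2) := by
  rcases lt_or_ge 0 c with hc | hc
  · have key : ∀ n, 1 ≤ critOrbit c (n + 1) := fun n => by
      rw [succ]; nlinarith [sq_nonneg (critOrbit c n)]
    refine ⟨by linarith [key (n + 1)], ?_⟩
    rw [abs_of_pos (by linarith [key n]), succ (n + 1)]
    nlinarith [sq_nonneg (critOrbit c (n + 1) - 1)]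
  · have hc3 : c ≤ -3 := by omega
    have key : ∀ n, -2 * c ≤ critOrbit c (n + 2) := fun n => by
      induction n with
      | zero => rw [zero_add, succ, one]; nlinarith
      | succ n ih => rw [succ]; nlinarith
    refine ⟨by linarith [key n], ?_⟩
    cases n with
    | zero => rw [zero_add, one, zero_add, succ, one, abs_of_neg (by linarith)]; nlinarith
    | succ n =>
      rw [abs_of_pos (by linarith [key n]), succ (n + 2)]
      nlinarith [key n]

lemma two_mul_abs_le (h0 : c ≠ 0) (h1 : c ≠ -1) (h2 : c ≠ -2) (n : ℕ) :
    2 * |critOrbit c (n + 1)| ≤ |critOrbit c (n + 2)| :=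
  (pos_and_two_mul_le h0 h1 h2 n).2.trans (le_abs_self _)

lemma abs_pos (h0 : c ≠ 0) (h1 : c ≠ -1) (h2 : c ≠ -2) (n : ℕ) :
    0 < |critOrbit c (n + 1)| := by
  cases n with
  | zero => simpa using h0
  | succ n => exact _root_.abs_pos.2 (pos_and_two_mul_le h0 h1 h2 n).1.ne'

lemma strictMono_abs (h0 : c ≠ 0) (h1 : c ≠ -1) (h2 : c ≠ -2) :
    StrictMono fun n => |critOrbit c (n + 1)| :=
  strictMono_nat_of_lt_succ fun n => by
    linarith [two_mul_abs_le h0 h1 h2 n, abs_pos h0 h1 h2 n]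

lemma two_mul_abs_lt_add (h0 : c ≠ 0) (h1 : c ≠ -1) (h2 : c ≠ -2) {j k : ℕ} (hj : 2 ≤ j)
    (hk : 1 ≤ k) : 2 * |critOrbit c k| < critOrbit c (j + k) + critOrbit c j := by
  obtain ⟨j, rfl⟩ := Nat.exists_eq_add_of_le' hj
  obtain ⟨k, rfl⟩ := Nat.exists_eq_add_of_le' hk
  have hpos := (pos_and_two_mul_le h0 h1 h2 j).1
  have hpos' := (pos_and_two_mul_le h0 h1 h2 (j + k + 1)).1
  have hmono := (strictMono_abs h0 h1 h2).monotone (show k + 1 ≤ j + k + 2 by omega)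
  have hdouble := two_mul_abs_le h0 h1 h2 k
  have heq : j + 2 + (k + 1) = j + k + 1 + 2 := by omega
  rw [heq]
  simp only [show j + k + 2 + 1 = j + k + 1 + 2 by omega, abs_of_pos hpos',
    show k + 1 + 1 = k + 2 by omega] at hmono
  linarith

/-! ### Divisibility -/

lemma sub_succ (j k : ℕ) : critOrbit c (j + 1 + k) - critOrbit c (j + 1) =
    (critOrbit c (j + k) - critOrbit c j) * (critOrbit c (j + k) + critOrbit c j) := by
  rw [show j + 1 + k = j + k + 1 by omega, succ, succ]; ring

lemma sub_dvd_sub (k : ℕ) {i j : ℕ} (h : i ≤ j) :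
    critOrbit c (i + k) - critOrbit c i ∣ critOrbit c (j + k) - critOrbit c j := by
  induction j, h using Nat.le_induction with
  | base => rfl
  | succ j _ ih => rw [sub_succ]; exact ih.mul_right _

lemma add_dvd_sub (k : ℕ) {i j : ℕ} (h : i < j) :
    critOrbit c (i + k) + critOrbit c i ∣ critOrbit c (j + k) - critOrbit c j :=
  (Dvd.intro_left _ (sub_succ i k).symm).trans (sub_dvd_sub k h)

lemma sq_dvd_sub (k : ℕ) {j : ℕ} (h : 1 ≤ j) :
    critOrbit c k ^ 2 ∣ critOrbit c (j + k) - critOrbit c j := by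
  have := sub_dvd_sub (c := c) k h
  rwa [show 1 + k = 0 + 1 + k by omega, show 1 = 0 + 1 from rfl, sub_succ, zero_add, zero,
    sub_zero, add_zero, ← sq] at this

lemma sq_dvd_mul_sub (k : ℕ) {l : ℕ} (hl : 1 ≤ l) :
    critOrbit c k ^ 2 ∣ critOrbit c (l * k) - critOrbit c k := by
  rcases Nat.eq_zero_or_pos k with rfl | hk
  · simp
  induction l, hl using Nat.le_induction with
  | base => simp
  | succ l hl ih =>
    have := dvd_add (sq_dvd_sub (c := c) k (j := l * k) (Nat.mul_pos hl hk)) ih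
    rwa [sub_add_sub_cancel, ← Nat.succ_mul] at this

lemma dvd_mul (k : ℕ) {l : ℕ} (hl : 1 ≤ l) : critOrbit c k ∣ critOrbit c (l * k) :=
  (dvd_sub_left dvd_rfl).1 ((dvd_pow_self _ two_ne_zero).trans (sq_dvd_mul_sub k hl))

/-- Rigid divisibility: if `p` divides `critOrbit c k`, then `critOrbit c l` divides
`critOrbit c k` up to a factor prime to `p`. -/
lemma exists_dvd_mul {p : ℤ} (hp : Prime p) {k l : ℕ} (hk : 1 ≤ k) (hl : 1 ≤ l)
    (hpk : p ∣ critOrbit c k) : ∃ r : ℤ, ¬ p ∣ r ∧ critOrbit c l ∣ critOrbit c k * r := by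
  obtain ⟨x, hx⟩ := sq_dvd_mul_sub (c := c) k hl
  refine ⟨1 + critOrbit c k * x, fun h => hp.not_dvd_one ?_, ?_⟩
  · exact (dvd_add_left (hpk.mul_right x)).1 h
  · have := dvd_mul (c := c) l hk
    rw [mul_comm, eq_add_of_sub_eq hx] at this
    convert this using 1; ring

lemma pow_dvd_of_pow_dvd {p : ℤ} (hp : Prime p) {k l i : ℕ} (hk : 1 ≤ k) (hl : 1 ≤ l)
    (hpk : p ∣ critOrbit c k) (h : p ^ i ∣ critOrbit c l) : p ^ i ∣ critOrbit c k := by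
  obtain ⟨r, hr, hd⟩ := exists_dvd_mul hp hk hl hpk
  exact hp.pow_dvd_of_dvd_mul_right i hr (h.trans hd)

lemma int_dvd_of_forall_prime_pow {x y : ℤ}
    (h : ∀ p : ℕ, p.Prime → (p : ℤ) ∣ x → ∀ i : ℕ, (p : ℤ) ^ i ∣ x → (p : ℤ) ^ i ∣ y) : x ∣ y := by
  rw [← Int.natAbs_dvd_natAbs, Nat.dvd_iff_prime_pow_dvd_dvd]
  intro p i hp hi
  rcases Nat.eq_zero_or_pos i with rfl | hi0
  · simp
  have hx : (p : ℤ) ^ i ∣ x := by exact_mod_cast Int.natCast_dvd.2 hi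
  have := h p hp ((dvd_pow_self _ hi0.ne').trans hx) i hx
  exact Int.natCast_dvd.1 (by exact_mod_cast this)

lemma dvd_of_forall_prime_dvd {k l : ℕ} (hk : 1 ≤ k) (hl : 1 ≤ l)
    (h : ∀ p : ℕ, p.Prime → (p : ℤ) ∣ critOrbit c l → (p : ℤ) ∣ critOrbit c k) :
    critOrbit c l ∣ critOrbit c k :=
  int_dvd_of_forall_prime_pow fun p hp hpl _ hi =>
    pow_dvd_of_pow_dvd (Nat.prime_iff_prime_int.1 hp) hk hl (h p hp hpl) hi

lemma dvd_of_dvd_of_dvd_sub {p : ℤ} {j k : ℕ} (hk : 1 ≤ k) (hj : p ∣ critOrbit c j)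
    (hT : p ∣ critOrbit c (j + k) - critOrbit c j) : p ∣ critOrbit c k := by
  have h1 : p ∣ critOrbit c (k + j) := by
    rw [add_comm]; exact (dvd_sub_left hj).1 hT
  have h2 := (hj.trans (dvd_pow_self _ two_ne_zero)).trans (sq_dvd_sub (c := c) j hk)
  exact (dvd_sub_right h1).1 h2

lemma two_dvd_of_two_dvd_sub {j k : ℕ} (hk : 1 ≤ k)
    (hT : 2 ∣ critOrbit c (j + k) - critOrbit c j) : 2 ∣ critOrbit c k := by
  by_cases hj : 2 ∣ critOrbit c j
  · exact dvd_of_dvd_of_dvd_sub hk hj hT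
  by_cases hc : 2 ∣ c
  · have := dvd_mul (c := c) 1 hk
    rw [one, mul_one] at this
    exact hc.trans this
  · refine dvd_of_dvd_of_dvd_sub (j := j + 1) hk ?_ (hT.trans (sub_dvd_sub k j.le_succ))
    have hj2 := Int.odd_iff.2 (Int.two_dvd_ne_zero.1 hj)
    have hc2 := Int.odd_iff.2 (Int.two_dvd_ne_zero.1 hc)
    rw [succ]
    exact (hj2.pow.add_odd hc2).two_dvd

/-- If passing from `j` to `j + 1` introduces no new prime divisor of the difference
`f^(j+k)(0) - f^j(0)`, then the factor gained divides `2 f^k(0)`. -/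
lemma add_dvd_two_mul {j k : ℕ} (hj : 2 ≤ j) (hk : 1 ≤ k)
    (h : ∀ p : ℕ, p.Prime → (p : ℤ) ∣ critOrbit c (j + k) + critOrbit c j →
      (p : ℤ) ∣ critOrbit c (j + k) - critOrbit c j) :
    critOrbit c (j + k) + critOrbit c j ∣ 2 * critOrbit c k := by
  refine int_dvd_of_forall_prime_pow fun p hp hpU i hi => ?_
  have hpT := h p hp hpU
  have hpp := Nat.prime_iff_prime_int.1 hp
  obtain ⟨t, ht⟩ : critOrbit c k ^ 2 * (critOrbit c k ^ 2 + 2 * c) ∣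
      critOrbit c (j + k) - critOrbit c j := by
    convert sub_dvd_sub (c := c) k hj using 1
    rw [sub_succ 1 k, sub_succ 0 k]
    simp [add_comm 1 k, succ]
    ring
  have hU : critOrbit c (j + k) + critOrbit c j =
      2 * critOrbit c j + critOrbit c k ^ 2 * (critOrbit c k ^ 2 + 2 * c) * t := by
    rw [← ht]; ring
  have hp2 : (p : ℤ) ∣ 2 * critOrbit c j := by
    rw [two_mul, ← add_sub_sub_cancel (critOrbit c (j + k))]
    exact dvd_sub hpU hpT
  have hpk : (p : ℤ) ∣ critOrbit c k := by
    rcases hpp.dvd_or_dvd hp2 with h2 | hj'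
    · obtain rfl := (Nat.prime_dvd_prime_iff_eq hp Nat.prime_two).1 (by exact_mod_cast h2)
      exact two_dvd_of_two_dvd_sub hk hpT
    · exact dvd_of_dvd_of_dvd_sub hk hj' hpT
  by_cases hpj : (p : ℤ) ∣ critOrbit c j
  · obtain ⟨r, hr, y, hy⟩ := exists_dvd_mul hpp hk (by omega : 1 ≤ j) hpk
    have hr2 : ¬ (p : ℤ) ∣ r ^ 2 := fun h => hr (hpp.dvd_of_dvd_pow h)
    suffices (p : ℤ) ^ i ∣ 2 * critOrbit c j by
      refine hpp.pow_dvd_of_dvd_mul_right i hr (this.trans ?_)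
      rw [mul_assoc, hy]
      exact mul_dvd_mul_left 2 (dvd_mul_right _ _)
    by_cases h2 : p = 2
    · subst h2
      obtain ⟨s, hs⟩ : (2 : ℤ) ∣ critOrbit c k ^ 2 + 2 * c :=
        dvd_add (hpk.trans (dvd_pow_self _ two_ne_zero)) (dvd_mul_right _ _)
      refine hpp.pow_dvd_of_dvd_mul_right (b := r ^ 2 + critOrbit c j * (y ^ 2 * s * t)) i
        (fun h => hr2 ((dvd_add_left (hpj.mul_right _)).1 h)) ?_
      convert hi.mul_right (r ^ 2) using 1
      rw [hU, hs]
      linear_combination (-2 * s * t * (critOrbit c k * r + critOrbit c j * y)) * hy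
    · have hr2' : ¬ (p : ℤ) ∣ 2 * r ^ 2 := fun h => by
        rcases hpp.dvd_or_dvd h with h | h
        · exact h2 ((Nat.prime_dvd_prime_iff_eq hp Nat.prime_two).1 (by exact_mod_cast h))
        · exact hr2 h
      refine Dvd.dvd.mul_left (hpp.pow_dvd_of_dvd_mul_right
        (b := 2 * r ^ 2 + critOrbit c j * (y ^ 2 * (critOrbit c k ^ 2 + 2 * c) * t)) i
        (fun h => hr2' ((dvd_add_left (hpj.mul_right _)).1 h)) ?_) 2
      convert hi.mul_right (r ^ 2) using 1
      rw [hU]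
      linear_combination (-(critOrbit c k ^ 2 + 2 * c) * t *
        (critOrbit c k * r + critOrbit c j * y)) * hy
  · obtain rfl := (Nat.prime_dvd_prime_iff_eq hp Nat.prime_two).1
      (by exact_mod_cast (hpp.dvd_or_dvd hp2).resolve_right hpj)
    obtain ⟨s, hs⟩ : (2 : ℤ) ∣ critOrbit c k ^ 2 + 2 * c :=
      dvd_add (hpk.trans (dvd_pow_self _ two_ne_zero)) (dvd_mul_right _ _)
    refine Dvd.dvd.mul_right (hpp.pow_dvd_of_dvd_mul_right
      (b := critOrbit c j + critOrbit c k * (critOrbit c k * s * t)) i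
      (fun h => hpj ((dvd_add_left (hpk.mul_right _)).1 h)) ?_) _
    rwa [show 2 * (critOrbit c j + critOrbit c k * (critOrbit c k * s * t)) =
      critOrbit c (j + k) + critOrbit c j by rw [hU, hs]; ring]

/-! ### Counting -/

/-- A prime dividing `f^(j+k)(0) + f^j(0)` but not `f^(j+k)(0) - f^j(0)`. -/
lemma exists_new_prime (h0 : c ≠ 0) (h1 : c ≠ -1) (h2 : c ≠ -2) {j k : ℕ} (hj : 2 ≤ j)
    (hk : 1 ≤ k) : ∃ p : ℕ, p.Prime ∧ (p : ℤ) ∣ critOrbit c (j + k) + critOrbit c j ∧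
      ¬ (p : ℤ) ∣ critOrbit c (j + k) - critOrbit c j := by
  by_contra! h
  obtain ⟨k, rfl⟩ := Nat.exists_eq_add_of_le' hk
  have hdvd := (dvd_abs _ _).2 (add_dvd_two_mul hj hk h)
  rw [abs_mul, abs_two] at hdvd
  have := Int.le_of_dvd (by linarith [abs_pos h0 h1 h2 k]) hdvd
  linarith [two_mul_abs_lt_add h0 h1 h2 hj hk]

lemma le_card_add_two (h0 : c ≠ 0) (h1 : c ≠ -1) (h2 : c ≠ -2) {S : Finset ℕ} {m k : ℕ}
    (hk : 1 ≤ k) (h : ∀ p : ℕ, p.Prime → (p : ℤ) ∣ critOrbit c (m + k) - critOrbit c m → p ∈ S) :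
    m ≤ S.card + 2 := by
  have hex := fun j (hj : j ∈ Finset.Ico 2 m) =>
    exists_new_prime h0 h1 h2 (Finset.mem_Ico.1 hj).1 hk
  choose! q hq hqU hqT using hex
  have hcard : (Finset.Ico 2 m).card ≤ S.card := by
    refine Finset.card_le_card_of_injOn q (fun j hj => ?_) (fun i hi j hj hij => ?_)
    · exact h _ (hq j hj) ((hqU j hj).trans (add_dvd_sub k (Finset.mem_Ico.1 hj).2))
    · rcases lt_trichotomy i j with hlt | heq | hlt
      · exact (hqT j hj (hij ▸ (hqU i hi).trans (add_dvd_sub k hlt))).elim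
      · exact heq
      · exact (hqT i hi (hij ▸ (hqU j hj).trans (add_dvd_sub k hlt))).elim
  rw [Nat.card_Ico] at hcard
  omega

/-- The indices of the terms of the critical orbit supported on `S`. -/
def supportedIndices (c : ℤ) (S : Finset ℕ) : Set ℕ :=
  { k | 1 ≤ k ∧ ∀ p : ℕ, p.Prime → (p : ℤ) ∣ critOrbit c k → p ∈ S }

lemma injOn_primeSupport (h0 : c ≠ 0) (h1 : c ≠ -1) (h2 : c ≠ -2) {S : Finset ℕ} :
    Set.InjOn (fun k => S.filter fun p : ℕ => (p : ℤ) ∣ critOrbit c k) (supportedIndices c S) := by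
  intro k hk l hl hkl
  have hdvd {k l : ℕ} (hk : k ∈ supportedIndices c S) (hl : l ∈ supportedIndices c S)
      (hkl : S.filter (fun p : ℕ => (p : ℤ) ∣ critOrbit c k) =
        S.filter fun p : ℕ => (p : ℤ) ∣ critOrbit c l) : critOrbit c k ∣ critOrbit c l :=
    dvd_of_forall_prime_dvd hl.1 hk.1 fun p hp hpk =>
      (Finset.mem_filter.1 (hkl.subset (Finset.mem_filter.2 ⟨hk.2 p hp hpk, hpk⟩))).2
  have habs : |critOrbit c k| = |critOrbit c l| := by
    rw [Int.abs_eq_natAbs, Int.abs_eq_natAbs,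
      Int.natAbs_eq_of_dvd_dvd (hdvd hk hl hkl) (hdvd hl hk hkl.symm)]
  obtain ⟨k, rfl⟩ := Nat.exists_eq_add_of_le' hk.1
  obtain ⟨l, rfl⟩ := Nat.exists_eq_add_of_le' hl.1
  rw [(strictMono_abs h0 h1 h2).injective habs]

end critOrbit

lemma mem_of_prime_dvd_of_mem_sUnitsQ {S : Finset ℕ} {z : ℤ} (hz : (z : ℚ) ∈ sUnitsQ S) {p : ℕ}
    (hp : p.Prime) (hpz : (p : ℤ) ∣ z) : p ∈ S := by
  by_contra hpS
  have := Fact.mk hp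
  exact (padicNorm.int_eq_one_iff z).1 (hz.2 p hp hpS) hpz

open critOrbit in
lemma diffOrbitSet_inter_sUnitsQ_subset {c : ℤ} (h0 : c ≠ 0) (h1 : c ≠ -1) (h2 : c ≠ -2)
    (S : Finset ℕ) : diffOrbitSet c ∩ sUnitsQ S ⊆
      (fun x : ℕ × ℕ => ((critOrbit c (x.2 + x.1) - critOrbit c x.2 : ℤ) : ℚ)) ''
        (supportedIndices c S ×ˢ Set.Iio (S.card + 3)) := by
  rintro y ⟨⟨n, m, hmn, hy⟩, hyS⟩
  obtain ⟨k, rfl⟩ := Nat.exists_eq_add_of_le hmn.le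
  have hk : 1 ≤ k := by omega
  rw [← intCast_eq, ← intCast_eq, ← Int.cast_sub] at hy
  subst hy
  have hS : ∀ p : ℕ, p.Prime → (p : ℤ) ∣ critOrbit c (m + k) - critOrbit c m → p ∈ S :=
    fun p hp => mem_of_prime_dvd_of_mem_sUnitsQ hyS hp
  refine ⟨(k, m), ⟨⟨hk, fun p hp hpk => hS p hp (hpk.trans ?_)⟩, ?_⟩, rfl⟩
  · simpa using sub_dvd_sub (c := c) k m.zero_le
  · exact Nat.lt_succ_of_le (le_card_add_two h0 h1 h2 hk hS)

/-- For a finite set `S` of rational primes there is a constant `C`,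
depending only on `S`, such that for every `c ∈ ℤ` with `c ∉ {0, −1, −2}`, the set
`{f_c^n(0) − f_c^m(0) : n > m ≥ 0} ∩ U_S` has at most `C` elements, where `U_S` is the group
of `S`-units of `ℚ`. -/
theorem stmt_19 (S : Finset ℕ) (hS : ∀ p ∈ S, p.Prime) :
    ∃ C : ℕ, ∀ c : ℤ, c ≠ 0 → c ≠ -1 → c ≠ -2 →
      (diffOrbitSet c ∩ sUnitsQ S).Finite ∧
      Nat.card ↥(diffOrbitSet c ∩ sUnitsQ S) ≤ C := by
  refine ⟨2 ^ S.card * (S.card + 3), fun c h0 h1 h2 => ?_⟩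
  have hinj := critOrbit.injOn_primeSupport h0 h1 h2 (S := S)
  have hmaps : Set.MapsTo (fun k => S.filter fun p : ℕ => (p : ℤ) ∣ critOrbit c k)
      (critOrbit.supportedIndices c S) S.powerset := fun k _ =>
    Finset.mem_coe.2 (Finset.mem_powerset.2 (Finset.filter_subset _ _))
  have hfin : (critOrbit.supportedIndices c S).Finite :=
    Set.Finite.of_injOn hmaps hinj S.powerset.finite_toSet
  have hcard : (critOrbit.supportedIndices c S).ncard ≤ 2 ^ S.card := by
    rw [← Finset.card_powerset, ← Set.ncard_coe_finset]
    exact Set.ncard_le_ncard_of_injOn _ hmaps hinj S.powerset.finite_toSet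
  have hprod := hfin.prod (Set.finite_Iio (S.card + 3))
  have hsub := diffOrbitSet_inter_sUnitsQ_subset h0 h1 h2 S
  refine ⟨(hprod.image _).subset hsub, ?_⟩
  calc Nat.card ↥(diffOrbitSet c ∩ sUnitsQ S)
      ≤ _ := Set.ncard_le_ncard hsub (hprod.image _)
    _ ≤ _ := Set.ncard_image_le hprod
    _ = (critOrbit.supportedIndices c S).ncard * (S.card + 3) := by
      rw [Set.ncard_prod, Set.ncard_Iio_nat]
    _ ≤ _ := Nat.mul_le_mul_right _ hcard
end
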